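/- arXiv:1206.5522 — 5 statements merged into one kernel-verified Lean document; each statement's English description precedes it below -/
import Mathlib

section
/- Let M and N be topological manifolds without boundary. Then the map ι : Emb(M,N) → Emb^∂(ℝ≥0 × M, ℝ≥0 × N), sending an open embedding g : M → N to the boundary-preserving open embedding id_{ℝ≥0} × g : ℝ≥0 × M → ℝ≥0 × N, is a homotopy equivalence of topological spaces: there exists a continuous map in the other direction such that both composites are homotopic (through continuous homotopies) to the respective identity maps. (This is the statement that the functor ℝ≥0 × − from (n−1)-manifolds to n-manifolds with boundary is homotopically fully faithful.) -/
open scoped NNReal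
open Topology

/-- The space of open topological embeddings `X → Y`, as a subspace of the space of
continuous maps with the compact-open topology. -/
abbrev EmbSp (X Y : Type*) [TopologicalSpace X] [TopologicalSpace Y] : Type _ :=
  {f : C(X, Y) // IsOpenEmbedding f}

/-- The space of boundary-preserving open topological embeddings
`ℝ≥0 × M → ℝ≥0 × N`: open embeddings sending `{0} × M` into `{0} × N` and
`(0,∞) × M` into `(0,∞) × N`, as a subspace of the continuous maps with the
compact-open topology. -/
abbrev EmbBdrySp (M N : Type*) [TopologicalSpace M] [TopologicalSpace N] : Type _ :=
  {F : C(ℝ≥0 × M, ℝ≥0 × N) //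
    IsOpenEmbedding F ∧ (∀ x : M, (F (0, x)).1 = 0) ∧
      ∀ (t : ℝ≥0) (x : M), 0 < t → 0 < (F (t, x)).1}

theorem continuous_of_continuous_uncurry_subtype {Z X Y : Type*} [TopologicalSpace Z]
    [TopologicalSpace X] [TopologicalSpace Y] {P : C(X, Y) → Prop} (f : Z → {f : C(X, Y) // P f})
    (h : Continuous fun p : Z × X => (f p.1).1 p.2) : Continuous f :=
  continuous_induced_rng.2 (ContinuousMap.continuous_of_continuous_uncurry _ h)

section Embeddings

variable {M N : Type*} [TopologicalSpace M] [TopologicalSpace N]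

/-- The restriction of a boundary-preserving embedding to the boundary. -/
def EmbBdrySp.boundary (F : EmbBdrySp M N) : EmbSp M N where
  val := ⟨fun x => (F.1 (0, x)).2, by fun_prop⟩
  property := by
    obtain ⟨F, hF, h0, hpos⟩ := F
    refine .of_continuous_injective_isOpenMap (by fun_prop) (fun x y hxy => ?_) fun U hU => ?_
    · have : F (0, x) = F (0, y) := Prod.ext ((h0 x).trans (h0 y).symm) hxy
      simpa using hF.injective this
    · have key : (fun x => (F (0, x)).2) '' U =
          (fun y : N => ((0 : ℝ≥0), y)) ⁻¹' (F '' (Set.univ ×ˢ U)) := by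
        ext y
        constructor
        · rintro ⟨x, hx, rfl⟩
          exact ⟨(0, x), ⟨trivial, hx⟩, Prod.ext (h0 x) rfl⟩
        · rintro ⟨⟨t, x⟩, ⟨-, hx⟩, hy⟩
          have ht : t = 0 := by
            by_contra ht
            have := hpos t x (pos_iff_ne_zero.2 ht)
            simp [hy] at this
          subst ht
          exact ⟨x, hx, by simp [hy]⟩
      change IsOpen ((fun x => (F (0, x)).2) '' U)
      rw [key]
      exact (hF.isOpenMap _ (isOpen_univ.prod hU)).preimage (by fun_prop)

/-- The boundary-preserving embedding `id × g`. -/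
def EmbSp.prodHalfline (g : EmbSp M N) : EmbBdrySp M N where
  val := ⟨fun p => (p.1, g.1 p.2), by fun_prop⟩
  property := ⟨IsOpenEmbedding.id.prodMap g.2, fun _ => rfl, fun _ _ ht => ht⟩

/-- Conjugation by the translation by `c` of the extension of a boundary-preserving embedding by
a product on the negative half-line. -/
def EmbBdrySp.shift (F : EmbBdrySp M N) (c : ℝ≥0) : EmbBdrySp M N where
  val := ⟨fun p => ((F.1 (p.1 - c, p.2)).1 + min p.1 c, (F.1 (p.1 - c, p.2)).2), by fun_prop⟩
  property := by
    obtain ⟨F, hF, h0, hpos⟩ := F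
    set G : ℝ≥0 × M → ℝ≥0 × N :=
      fun p => ((F (p.1 - c, p.2)).1 + min p.1 c, (F (p.1 - c, p.2)).2) with hG
    have hsub (p) : (G p).1 - c = (F (p.1 - c, p.2)).1 := by
      rcases le_total p.1 c with h | h
      · simp [hG, tsub_eq_zero_of_le h, h0, h]
      · simp [hG, h]
    have hmin (p) : min (G p).1 c = min p.1 c := by
      rcases le_total p.1 c with h | h
      · simp [hG, tsub_eq_zero_of_le h, h0]
      · simp [hG, h]
    have hF_sub (p) : F (p.1 - c, p.2) = ((G p).1 - c, (G p).2) :=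
      Prod.ext (hsub p).symm rfl
    have hadd (t : ℝ≥0) : t - c + min t c = t := by
      rcases le_total t c with h | h
      · simp [h, tsub_eq_zero_of_le h]
      · simp [h, tsub_add_cancel_of_le h]
    have hcont : Continuous G := by fun_prop
    refine ⟨.of_continuous_injective_isOpenMap hcont ?_ fun U hU => ?_, ?_, ?_⟩
    · intro p q (hpq : G p = G q)
      have h1 : (p.1 - c, p.2) = (q.1 - c, q.2) := hF.injective <| by
        rw [hF_sub, hF_sub, hpq]
      have h2 : min p.1 c = min q.1 c := by rw [← hmin, ← hmin, hpq]
      obtain ⟨h3, h4⟩ := Prod.mk.inj h1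
      exact Prod.ext (by rw [← hadd p.1, ← hadd q.1, h2, h3]) h4
    · have key : G '' U = (fun q : ℝ≥0 × N => ((q.1 - c, q.2), q)) ⁻¹'
          (Prod.map F id '' {z : (ℝ≥0 × M) × (ℝ≥0 × N) |
            (z.1.1 + min z.2.1 c, z.1.2) ∈ U}) := by
        ext q
        constructor
        · rintro ⟨p, hp, rfl⟩
          exact ⟨((p.1 - c, p.2), G p), by simpa [hmin, hadd] using hp,
            Prod.ext (hF_sub p) rfl⟩
        · rintro ⟨⟨⟨t, x⟩, q'⟩, hz, hq⟩
          obtain ⟨hq1, rfl⟩ : F (t, x) = (q.1 - c, q.2) ∧ q' = q := by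
            simpa [Prod.ext_iff] using hq
          refine ⟨_, hz, ?_⟩
          rcases le_or_gt q'.1 c with h | h
          · have ht : t = 0 := by
              by_contra ht
              have := hpos t x (pos_iff_ne_zero.2 ht)
              simp [hq1, tsub_eq_zero_of_le h] at this
            subst ht
            simp [hG, h, tsub_eq_zero_of_le h, hq1]
          · simp [hG, h.le, hq1, tsub_add_cancel_of_le h.le]
      change IsOpen (G '' U)
      rw [key]
      refine ((hF.isOpenMap.prodMap IsOpenMap.id) _ ?_).preimage (by fun_prop)
      exact hU.preimage (by fun_prop)
    · intro x
      change (F (0 - c, x)).1 + min 0 c = 0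
      simp [h0]
    · intro t x ht
      change 0 < (F (t - c, x)).1 + min t c
      rcases le_or_gt t c with h | h
      · simp [h, ht]
      · exact add_pos_of_pos_of_nonneg (hpos _ _ (tsub_pos_of_lt h)) zero_le

/-- The shifts of a boundary-preserving embedding, extended to `c = ∞` by the product of its
boundary restriction with the half-line. -/
noncomputable def EmbBdrySp.extendedShift (F : EmbBdrySp M N) : ENNReal → EmbBdrySp M N
  | ⊤ => F.boundary.prodHalfline
  | (c : ℝ≥0) => F.shift c

theorem EmbBdrySp.extendedShift_top (F : EmbBdrySp M N) :
    F.extendedShift ⊤ = F.boundary.prodHalfline := rfl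

theorem EmbBdrySp.extendedShift_apply (F : EmbBdrySp M N) (c : ENNReal) (p : ℝ≥0 × M) :
    (F.extendedShift c).1 p =
      ((F.1 (p.1 - (min (p.1 : ENNReal) c).toNNReal, p.2)).1 + (min (p.1 : ENNReal) c).toNNReal,
        (F.1 (p.1 - (min (p.1 : ENNReal) c).toNNReal, p.2)).2) := by
  induction c with
  | top =>
    simp [extendedShift_top, boundary, EmbSp.prodHalfline, F.2.2.1]
  | coe c =>
    have : p.1 - min p.1 c = p.1 - c := by
      rcases le_total p.1 c with h | h <;> simp [h, tsub_eq_zero_of_le]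
    rw [← ENNReal.coe_min, ENNReal.toNNReal_coe, this]
    rfl

theorem EmbBdrySp.extendedShift_zero (F : EmbBdrySp M N) : F.extendedShift 0 = F := by
  refine Subtype.ext (ContinuousMap.ext fun p => ?_)
  simp [extendedShift_apply]

theorem EmbBdrySp.continuous_extendedShift [LocallyCompactSpace M] :
    Continuous fun p : ENNReal × EmbBdrySp M N => p.2.extendedShift p.1 := by
  refine continuous_of_continuous_uncurry_subtype _ ?_
  simp only [extendedShift_apply]
  have hm : Continuous fun p : (ENNReal × EmbBdrySp M N) × (ℝ≥0 × M) =>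
      (min (p.2.1 : ENNReal) p.1.1).toNNReal :=
    ENNReal.continuousOn_toNNReal.comp_continuous
      ((ENNReal.continuous_coe.comp (by fun_prop)).min (by fun_prop)) fun p => by simp
  fun_prop

end Embeddings

/-- For topological manifolds `M` and `N` (without boundary), the map
`ι : Emb(M,N) → Emb^∂(ℝ≥0 × M, ℝ≥0 × N)`, `g ↦ id × g`, is a homotopy equivalence. -/
theorem product_with_halfline_fully_faithful
    (m n : ℕ) (M N : Type*)
    [TopologicalSpace M] [T2Space M] [SecondCountableTopology M]
    [ChartedSpace (EuclideanSpace ℝ (Fin m)) M]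
    [TopologicalSpace N] [T2Space N] [SecondCountableTopology N]
    [ChartedSpace (EuclideanSpace ℝ (Fin n)) N] :
    ∃ ι : C(EmbSp M N, EmbBdrySp M N),
      (∀ (g : EmbSp M N) (p : ℝ≥0 × M), (ι g).1 p = (p.1, g.1 p.2)) ∧
      ∃ r : C(EmbBdrySp M N, EmbSp M N),
        (r.comp ι).Homotopic (ContinuousMap.id _) ∧
        (ι.comp r).Homotopic (ContinuousMap.id _) := by
  have : LocallyCompactSpace M := ChartedSpace.locallyCompactSpace (EuclideanSpace ℝ (Fin m)) M
  refine ⟨⟨EmbSp.prodHalfline, continuous_of_continuous_uncurry_subtype _ ?_⟩, fun _ _ => rfl,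
    ⟨EmbBdrySp.boundary, continuous_of_continuous_uncurry_subtype _ ?_⟩, ?_,
    ⟨⟨⟨fun p => p.2.extendedShift ((unitInterval.toNNReal p.1 : ENNReal)⁻¹ - 1), ?_⟩,
      fun F => ?_, fun F => ?_⟩⟩⟩
  · change Continuous fun p : EmbSp M N × (ℝ≥0 × M) => (p.2.1, p.1.1 p.2.2)
    fun_prop
  · change Continuous fun p : EmbBdrySp M N × M => (p.1.1 (0, p.2)).2
    fun_prop
  · exact .refl _
  · refine EmbBdrySp.continuous_extendedShift.comp (.prodMk ?_ continuous_snd)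
    exact (ENNReal.continuous_sub_right 1).comp <| continuous_inv.comp <|
      ENNReal.continuous_coe.comp <| unitInterval.toNNReal_continuous.comp continuous_fst
  · simp [EmbBdrySp.extendedShift_top]
  · simp [EmbBdrySp.extendedShift_zero]
end

section
/- Let M and N be topological manifolds without boundary. For F ∈ Emb^∂(ℝ≥0 × M, ℝ≥0 × N), let r(F) : M → N be the map sending x ∈ M to the N-component of F(0,x). Then: (1) r(F) is an open topological embedding of M into N; (2) the resulting map r : Emb^∂(ℝ≥0 × M, ℝ≥0 × N) → Emb(M,N) is continuous for the compact-open topologies; (3) r ∘ ι is the identity of Emb(M,N), where ι(g) = id_{ℝ≥0} × g; and (4) ι ∘ r is homotopic to the identity of Emb^∂(ℝ≥0 × M, ℝ≥0 × N). In particular the image of ι is a deformation retract of Emb^∂(ℝ≥0 × M, ℝ≥0 × N) up to homotopy, the retraction being given by 'pushing off to infinity' in the ℝ≥0 direction. -/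
open scoped NNReal
open Topology

namespace EmbBdrySp

variable {M N : Type*} [TopologicalSpace M] [TopologicalSpace N]

/-- The boundary restriction of a boundary-preserving open embedding is an open embedding. -/
theorem isOpenEmbedding_restrict (F : EmbBdrySp M N) :
    IsOpenEmbedding (fun x : M => (F.1 (0, x)).2) := by
  obtain ⟨F, hF, h0, hpos⟩ := F
  refine .of_continuous_injective_isOpenMap (by fun_prop) ?_ ?_
  · intro x y hxy
    exact congrArg Prod.snd (hF.injective (Prod.ext ((h0 x).trans (h0 y).symm) hxy))
  · intro U hU
    have hopen : IsOpen ((fun y : N => ((0 : ℝ≥0), y)) ⁻¹' (F '' (Prod.snd ⁻¹' U))) :=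
      (hF.isOpenMap _ (hU.preimage continuous_snd)).preimage (by fun_prop)
    convert hopen using 1
    ext y
    constructor
    · rintro ⟨x, hx, rfl⟩
      exact ⟨(0, x), hx, Prod.ext (h0 x) rfl⟩
    · rintro ⟨⟨t, x⟩, hx, hy⟩
      obtain rfl : t = 0 := by
        by_contra ht
        exact (hpos t x (pos_iff_ne_zero.2 ht)).ne' (congrArg Prod.fst hy)
      exact ⟨x, hx, congrArg Prod.snd hy⟩

/-- The boundary restriction, as an element of the space of open embeddings. -/
def restrict (F : EmbBdrySp M N) : EmbSp M N :=
  ⟨⟨fun x => (F.1 (0, x)).2, by fun_prop⟩, F.isOpenEmbedding_restrict⟩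

/-- The product of an open embedding with the identity of the half-line. -/
def idProd (g : EmbSp M N) : EmbBdrySp M N :=
  ⟨⟨fun p => (p.1, g.1 p.2), by fun_prop⟩, IsOpenEmbedding.id.prodMap g.2,
    fun _ => rfl, fun _ _ ht => ht⟩

/-- The embedding `F` pushed away from the boundary by `s`: it is `id × restrict F` on
`[0,s] × M`, and the translate of `F` by `s` on `[s,∞) × M`. -/
def pushFun (s : ℝ≥0) (F : ℝ≥0 × M → ℝ≥0 × N) (p : ℝ≥0 × M) : ℝ≥0 × N :=
  (min p.1 s + (F (p.1 - s, p.2)).1, (F (p.1 - s, p.2)).2)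

theorem pushFun_of_le (F : EmbBdrySp M N) {s t : ℝ≥0} (h : t ≤ s) (x : M) :
    pushFun s F.1 (t, x) = (t, (F.1 (0, x)).2) := by
  simp [pushFun, h, tsub_eq_zero_of_le h, F.2.2.1 x]

theorem pushFun_add (F : EmbBdrySp M N) (s t : ℝ≥0) (x : M) :
    pushFun s F.1 (t + s, x) = (s + (F.1 (t, x)).1, (F.1 (t, x)).2) := by
  simp [pushFun]

theorem lt_pushFun_fst (F : EmbBdrySp M N) {s t : ℝ≥0} (h : s < t) (x : M) :
    s < (pushFun s F.1 (t, x)).1 := by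
  simpa [pushFun, h.le] using F.2.2.2 (t - s) x (tsub_pos_of_lt h)

theorem pushFun_injective (F : EmbBdrySp M N) (s : ℝ≥0) :
    Function.Injective (pushFun s F.1) := by
  rintro ⟨t, x⟩ ⟨t', x'⟩ h
  have h1 := congrArg Prod.fst h
  rcases le_or_gt t s with ht | ht <;> rcases le_or_gt t' s with ht' | ht'
  · rw [pushFun_of_le F ht, pushFun_of_le F ht', Prod.mk.injEq] at h
    exact Prod.ext h.1 (F.isOpenEmbedding_restrict.injective h.2)
  · have := lt_pushFun_fst F ht' x'
    rw [← h1, pushFun_of_le F ht] at this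
    exact absurd ht this.not_ge
  · have := lt_pushFun_fst F ht x
    rw [h1, pushFun_of_le F ht'] at this
    exact absurd ht' this.not_ge
  · obtain ⟨a, rfl⟩ := exists_add_of_le ht.le
    obtain ⟨b, rfl⟩ := exists_add_of_le ht'.le
    rw [add_comm s a, add_comm s b, pushFun_add, pushFun_add, Prod.mk.injEq,
      add_right_inj] at h
    have := F.2.1.injective (Prod.ext h.1 h.2)
    simp_all

theorem isOpenMap_pushFun (F : EmbBdrySp M N) (s : ℝ≥0) : IsOpenMap (pushFun s F.1) := by
  intro W hW
  let A : Set (ℝ≥0 × N) := (idProd F.restrict).1 '' W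
  let B : Set (ℝ≥0 × N) :=
    (fun q => (q.1 - s, q.2)) ⁻¹' (F.1 '' ((fun p : ℝ≥0 × M => (p.1 + s, p.2)) ⁻¹' W))
  have hA : IsOpen A := (idProd F.restrict).2.1.isOpenMap W hW
  have hB : IsOpen B :=
    (F.2.1.isOpenMap _ (hW.preimage (by fun_prop))).preimage (by fun_prop)
  have himage : pushFun s F.1 '' W =
      {q | q.1 ≤ s → q ∈ A} ∩ {q | s ≤ q.1 → q ∈ B} := by
    ext ⟨c, y⟩
    constructor
    · rintro ⟨⟨t, x⟩, hp, hq⟩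
      constructor
      · intro hc
        have ht : t ≤ s := by
          by_contra! ht
          have := lt_pushFun_fst F ht x
          rw [hq] at this
          exact this.not_ge hc
        rw [pushFun_of_le F ht] at hq
        exact ⟨(t, x), hp, hq⟩
      · intro hc
        have ht : s ≤ t := by
          by_contra! ht
          rw [pushFun_of_le F ht.le, Prod.mk.injEq] at hq
          exact (ht.trans_le hc).ne hq.1
        obtain ⟨a, rfl⟩ := exists_add_of_le ht
        rw [add_comm s a] at hp hq
        rw [pushFun_add, Prod.mk.injEq] at hq
        refine ⟨(a, x), hp, Prod.ext ?_ hq.2⟩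
        simp [← hq.1]
    · rintro ⟨h1, h2⟩
      rcases le_total c s with hc | hc
      · obtain ⟨⟨t, x⟩, hp, hq⟩ := h1 hc
        obtain ⟨rfl, hy⟩ := Prod.mk.inj hq
        exact ⟨(t, x), hp, (pushFun_of_le F hc x).trans hq⟩
      · obtain ⟨⟨t, x⟩, hp, hq⟩ := h2 hc
        refine ⟨(t + s, x), hp, ?_⟩
        rw [pushFun_add, hq]
        exact Prod.ext (add_tsub_cancel_of_le hc) rfl
  rw [himage]
  refine IsOpen.inter ?_ ?_
  · have : IsOpen ({q : ℝ≥0 × N | s < q.1} ∪ A) :=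
      (isOpen_lt continuous_const continuous_fst).union hA
    simpa only [Set.union_def, Set.mem_ofPred_eq, ← not_le, ← imp_iff_not_or] using this
  · have : IsOpen ({q : ℝ≥0 × N | q.1 < s} ∪ B) :=
      (isOpen_lt continuous_fst continuous_const).union hB
    simpa only [Set.union_def, Set.mem_ofPred_eq, ← not_le, ← imp_iff_not_or] using this

theorem pushFun_pos (F : EmbBdrySp M N) (s : ℝ≥0) {t : ℝ≥0} (ht : 0 < t) (x : M) :
    0 < (pushFun s F.1 (t, x)).1 := by
  rcases le_or_gt t s with h | h
  · rwa [pushFun_of_le F h]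
  · exact zero_le.trans_lt (lt_pushFun_fst F h x)

/-- Pushing a boundary-preserving embedding off by `s ∈ [0,∞]`, as a continuous map. Only the
finite number `min t s` matters at height `t`, so this makes sense for `s = ∞`. -/
def pushMap (s : ENNReal) (F : EmbBdrySp M N) : C(ℝ≥0 × M, ℝ≥0 × N) where
  toFun p := pushFun (min (p.1 : ENNReal) s).toNNReal F.1 p
  continuous_toFun := by
    have : Continuous fun p : ℝ≥0 × M => (min (p.1 : ENNReal) s).toNNReal :=
      ENNReal.continuousOn_toNNReal.comp_continuous (by fun_prop) fun p => by simp
    unfold pushFun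
    fun_prop

theorem pushMap_coe (F : EmbBdrySp M N) (s : ℝ≥0) : ⇑(pushMap s F) = pushFun s F.1 := by
  funext p
  simp only [pushMap, ContinuousMap.coe_mk, ← ENNReal.coe_min, ENNReal.toNNReal_coe]
  rcases le_total p.1 s with h | h <;> simp [pushFun, h, tsub_eq_zero_of_le]

theorem pushMap_top (F : EmbBdrySp M N) : pushMap ⊤ F = (idProd F.restrict).1 := by
  ext1 p
  simp only [pushMap, ContinuousMap.coe_mk, min_top_right, ENNReal.toNNReal_coe]
  exact pushFun_of_le F le_rfl p.2

/-- Pushing a boundary-preserving embedding off by `s ∈ [0,∞]`. -/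
def push (s : ENNReal) (F : EmbBdrySp M N) : EmbBdrySp M N :=
  ⟨pushMap s F, by
    induction s with
    | top =>
      rw [pushMap_top]
      exact (idProd F.restrict).2
    | coe s =>
      rw [pushMap_coe]
      exact ⟨.of_continuous_injective_isOpenMap (pushMap_coe F s ▸ (pushMap s F).continuous)
        (pushFun_injective F s) (isOpenMap_pushFun F s),
        fun x => by rw [pushFun_of_le F zero_le],
        fun _ x ht => pushFun_pos F s ht x⟩⟩

theorem push_top (F : EmbBdrySp M N) : push ⊤ F = idProd F.restrict :=
  Subtype.ext (pushMap_top F)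

theorem push_zero (F : EmbBdrySp M N) : push 0 F = F := by
  refine Subtype.ext (DFunLike.coe_injective ?_)
  rw [push, ← ENNReal.coe_zero, pushMap_coe]
  funext p
  simp [pushFun]

theorem continuous_restrict : Continuous (restrict : EmbBdrySp M N → EmbSp M N) := by
  let j : C(M, ℝ≥0 × M) := ⟨fun x => (0, x), by fun_prop⟩
  let π : C(ℝ≥0 × N, N) := ⟨Prod.snd, continuous_snd⟩
  exact (((ContinuousMap.continuous_postcomp π).comp
    (ContinuousMap.continuous_precomp j)).comp continuous_subtype_val).subtype_mk _

theorem continuous_idProd [LocallyCompactSpace M] :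
    Continuous (idProd : EmbSp M N → EmbBdrySp M N) := by
  refine Continuous.subtype_mk (ContinuousMap.continuous_of_continuous_uncurry _ ?_) _
  change Continuous fun q : EmbSp M N × (ℝ≥0 × M) => (q.2.1, q.1.1 q.2.2)
  fun_prop

theorem continuous_push [LocallyCompactSpace M] :
    Continuous fun q : ENNReal × EmbBdrySp M N => push q.1 q.2 := by
  refine Continuous.subtype_mk (ContinuousMap.continuous_of_continuous_uncurry _ ?_) _
  change Continuous fun q : (ENNReal × EmbBdrySp M N) × (ℝ≥0 × M) =>
    pushFun (min (q.2.1 : ENNReal) q.1.1).toNNReal q.1.2.1 q.2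
  have : Continuous fun q : (ENNReal × EmbBdrySp M N) × (ℝ≥0 × M) =>
      (min (q.2.1 : ENNReal) q.1.1).toNNReal :=
    ENNReal.continuousOn_toNNReal.comp_continuous (by fun_prop) fun p => by simp
  unfold pushFun
  fun_prop

/-- `id × restrict F` is homotopic to `F`, by pushing `F` off to infinity. -/
noncomputable def pushHomotopy [LocallyCompactSpace M] :
    (ContinuousMap.comp ⟨idProd, continuous_idProd⟩
      (⟨restrict, continuous_restrict⟩ : C(EmbBdrySp M N, EmbSp M N))).Homotopy
      (ContinuousMap.id _) where
  toFun q := push ((ENNReal.ofReal q.1)⁻¹ - 1) q.2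
  continuous_toFun := by
    have h : Continuous fun q : unitInterval × EmbBdrySp M N =>
        (ENNReal.ofReal q.1)⁻¹ - 1 :=
      (ENNReal.continuous_sub_right 1).comp
        (ENNReal.continuous_ofReal.comp (by fun_prop)).inv
    exact continuous_push.comp (h.prodMk continuous_snd)
  map_zero_left F := by simp [push_top]
  map_one_left F := by simp [push_zero]

end EmbBdrySp

/-- For topological manifolds `M` and `N` (without boundary): restriction to the
boundary, `r(F) x = (F (0,x)).2`, yields (1) an open embedding `M → N` for every
boundary-preserving open embedding `F : ℝ≥0 × M → ℝ≥0 × N`; (2) a continuous map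
`r : Emb^∂(ℝ≥0 × M, ℝ≥0 × N) → Emb(M,N)`; (3) a retraction of
`ι : g ↦ id_{ℝ≥0} × g`, i.e. `r ∘ ι = id`; and (4) `ι ∘ r` is homotopic to the
identity ("pushing off to infinity" in the `ℝ≥0`-direction). -/
theorem halfline_retraction
    (m n : ℕ) (M N : Type*)
    [TopologicalSpace M] [T2Space M] [SecondCountableTopology M]
    [ChartedSpace (EuclideanSpace ℝ (Fin m)) M]
    [TopologicalSpace N] [T2Space N] [SecondCountableTopology N]
    [ChartedSpace (EuclideanSpace ℝ (Fin n)) N] :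
    (∀ F : EmbBdrySp M N, IsOpenEmbedding (fun x : M => (F.1 (0, x)).2)) ∧
    ∃ r : C(EmbBdrySp M N, EmbSp M N),
      (∀ (F : EmbBdrySp M N) (x : M), (r F).1 x = (F.1 (0, x)).2) ∧
      ∃ ι : C(EmbSp M N, EmbBdrySp M N),
        (∀ (g : EmbSp M N) (p : ℝ≥0 × M), (ι g).1 p = (p.1, g.1 p.2)) ∧
        (∀ g : EmbSp M N, r (ι g) = g) ∧
        (ι.comp r).Homotopic (ContinuousMap.id _) := by
  have := ChartedSpace.locallyCompactSpace (EuclideanSpace ℝ (Fin m)) M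
  exact ⟨EmbBdrySp.isOpenEmbedding_restrict,
    ⟨EmbBdrySp.restrict, EmbBdrySp.continuous_restrict⟩, fun _ _ => rfl,
    ⟨EmbBdrySp.idProd, EmbBdrySp.continuous_idProd⟩, fun _ _ => rfl, fun _ => rfl,
    ⟨EmbBdrySp.pushHomotopy⟩⟩
end

section
/- Let L, M, N be topological spaces with M and N locally compact and Hausdorff. Let ψ : M → N be an open topological embedding which is an isotopy equivalence. Then post-composition with ψ defines a homotopy equivalence Emb(L,M) → Emb(L,N), f ↦ ψ ∘ f, of spaces of open embeddings with the compact-open topology. (This expresses that an isotopy equivalence becomes an equivalence in the topological category of manifolds and embeddings with the compact-open topology.) -/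
open Topology

/-- An isotopy `K : [0,1] × Y → Z` through open embeddings induces by post-composition a homotopy
between the maps of spaces of open embeddings induced by its ends. -/
theorem EmbSp.homotopic_of_isotopy {X Y Z : Type*} [TopologicalSpace X] [TopologicalSpace Y]
    [TopologicalSpace Z] [LocallyCompactSpace Y] (K : C(unitInterval × Y, Z))
    (hK : ∀ t : unitInterval, IsOpenEmbedding fun y : Y => K (t, y))
    (F G : C(EmbSp X Y, EmbSp X Z))
    (hF : ∀ (f : EmbSp X Y) (x : X), (F f).1 x = K (0, f.1 x))
    (hG : ∀ (f : EmbSp X Y) (x : X), (G f).1 x = K (1, f.1 x)) :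
    F.Homotopic G :=
  ⟨{ toFun := fun p => ⟨(K.curry p.1).comp p.2.1, (hK p.1).comp p.2.2⟩
     continuous_toFun := by
       refine Continuous.subtype_mk ?_ _
       exact (K.curry.continuous.comp continuous_fst).compCM
         (continuous_subtype_val.comp continuous_snd)
     map_zero_left := fun f => Subtype.ext <| ContinuousMap.ext fun x => (hF f x).symm
     map_one_left := fun f => Subtype.ext <| ContinuousMap.ext fun x => (hG f x).symm }⟩

/-- Post-composition with an open embedding, as a map of spaces of open embeddings. -/
def EmbSp.postcomp (X : Type*) {Y Z : Type*} [TopologicalSpace X] [TopologicalSpace Y]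
    [TopologicalSpace Z] (g : C(Y, Z)) (hg : IsOpenEmbedding g) : C(EmbSp X Y, EmbSp X Z) where
  toFun f := ⟨g.comp f.1, hg.comp f.2⟩
  continuous_toFun :=
    ((ContinuousMap.continuous_postcomp g).comp continuous_subtype_val).subtype_mk _

/-- If `ψ : M → N` is an open topological embedding which is an isotopy equivalence
(there is a continuous `H : [0,1] × M → N`, an open embedding at each time, with
`H(0,·) = ψ` and `H(1,·)` a homeomorphism of `M` onto `N`), then post-composition
with `ψ` is a homotopy equivalence `Emb(L,M) → Emb(L,N)` for the compact-open
topologies, for `M`, `N` locally compact Hausdorff. -/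
theorem postcomposition_with_isotopy_equivalence_is_homotopy_equivalence
    (L M N : Type*) [TopologicalSpace L] [TopologicalSpace M] [TopologicalSpace N]
    [LocallyCompactSpace M] [T2Space M] [LocallyCompactSpace N] [T2Space N]
    (ψ : C(M, N)) (hψ : IsOpenEmbedding ψ)
    (H : C(unitInterval × M, N))
    (hH : ∀ t : unitInterval, IsOpenEmbedding fun x : M => H (t, x))
    (hH0 : ∀ x : M, H (0, x) = ψ x)
    (hH1 : IsHomeomorph fun x : M => H (1, x)) :
    ∃ P : C(EmbSp L M, EmbSp L N),
      (∀ (f : EmbSp L M) (x : L), (P f).1 x = ψ (f.1 x)) ∧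
      ∃ Q : C(EmbSp L N, EmbSp L M),
        (P.comp Q).Homotopic (ContinuousMap.id _) ∧
        (Q.comp P).Homotopic (ContinuousMap.id _) := by
  let h : M ≃ₜ N := hH1.homeomorph
  refine ⟨EmbSp.postcomp L ψ hψ, fun _ _ => rfl,
    EmbSp.postcomp L (h.symm : C(N, M)) h.symm.isOpenEmbedding, ?_, ?_⟩
  · refine EmbSp.homotopic_of_isotopy
      (H.comp ((ContinuousMap.id unitInterval).prodMap (h.symm : C(N, M))))
      (fun t => (hH t).comp h.symm.isOpenEmbedding) _ _ (fun f x => (hH0 _).symm) fun f x => ?_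
    exact (h.apply_symm_apply (f.1 x)).symm
  · refine EmbSp.homotopic_of_isotopy ((h.symm : C(N, M)).comp H)
      (fun t => h.symm.isOpenEmbedding.comp (hH t)) _ _
      (fun f x => congrArg h.symm (hH0 _).symm) fun f x => ?_
    exact (h.symm_apply_apply (f.1 x)).symm
end

section
/- Let L, M, N be topological spaces with M and N locally compact and Hausdorff. Let ψ : M → N be an open topological embedding which is an isotopy equivalence. Then pre-composition with ψ defines a homotopy equivalence Emb(N,L) → Emb(M,L), g ↦ g ∘ ψ, of spaces of open embeddings with the compact-open topology. -/
open Topology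

/-- Pre-composition with an open embedding, as a continuous map of spaces of open embeddings. -/
def EmbSp.precomp {X Y : Type*} (L : Type*) [TopologicalSpace X] [TopologicalSpace Y]
    [TopologicalSpace L] (φ : C(X, Y)) (hφ : IsOpenEmbedding φ) : C(EmbSp Y L, EmbSp X L) where
  toFun g := ⟨g.1.comp φ, g.2.comp hφ⟩
  continuous_toFun :=
    ((ContinuousMap.continuous_precomp φ).comp continuous_subtype_val).subtype_mk _

/-- An isotopy of open embeddings induces a homotopy between the pre-composition maps. -/
theorem EmbSp.precomp_homotopic {X Y : Type*} (L : Type*) [TopologicalSpace X]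
    [TopologicalSpace Y] [TopologicalSpace L] [LocallyCompactSpace Y]
    (K : C(unitInterval × X, Y)) (hK : ∀ t, IsOpenEmbedding fun x => K (t, x))
    {φ₀ φ₁ : C(X, Y)} (hφ₀ : IsOpenEmbedding φ₀) (hφ₁ : IsOpenEmbedding φ₁)
    (h₀ : ∀ x, K (0, x) = φ₀ x) (h₁ : ∀ x, K (1, x) = φ₁ x) :
    (EmbSp.precomp L φ₀ hφ₀).Homotopic (EmbSp.precomp L φ₁ hφ₁) :=
  ⟨{ toFun := fun p => ⟨p.2.1.comp (K.curry p.1), p.2.2.comp (hK p.1)⟩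
     continuous_toFun := Continuous.subtype_mk
       ((continuous_subtype_val.comp continuous_snd).compCM
         (K.curry.continuous.comp continuous_fst)) _
     map_zero_left := fun g => Subtype.ext <| ContinuousMap.ext fun x => congrArg g.1 (h₀ x)
     map_one_left := fun g => Subtype.ext <| ContinuousMap.ext fun x => congrArg g.1 (h₁ x) }⟩

/-- If `ψ : M → N` is an open topological embedding which is an isotopy equivalence
(there is a continuous `H : [0,1] × M → N`, an open embedding at each time, with
`H(0,·) = ψ` and `H(1,·)` a homeomorphism of `M` onto `N`), then pre-composition
with `ψ` is a homotopy equivalence `Emb(N,L) → Emb(M,L)` for the compact-open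
topologies, for `M`, `N` locally compact Hausdorff. -/
theorem precomposition_with_isotopy_equivalence_is_homotopy_equivalence
    (L M N : Type*) [TopologicalSpace L] [TopologicalSpace M] [TopologicalSpace N]
    [LocallyCompactSpace M] [T2Space M] [LocallyCompactSpace N] [T2Space N]
    (ψ : C(M, N)) (hψ : IsOpenEmbedding ψ)
    (H : C(unitInterval × M, N))
    (hH : ∀ t : unitInterval, IsOpenEmbedding fun x : M => H (t, x))
    (hH0 : ∀ x : M, H (0, x) = ψ x)
    (hH1 : IsHomeomorph fun x : M => H (1, x)) :
    ∃ P : C(EmbSp N L, EmbSp M L),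
      (∀ (g : EmbSp N L) (x : M), (P g).1 x = g.1 (ψ x)) ∧
      ∃ Q : C(EmbSp M L, EmbSp N L),
        (P.comp Q).Homotopic (ContinuousMap.id _) ∧
        (Q.comp P).Homotopic (ContinuousMap.id _) := by
  let e : M ≃ₜ N := hH1.homeomorph
  have he (x : M) : H (1, x) = e x := rfl
  let ε : C(N, M) := ⟨e.symm, e.symm.continuous⟩
  have hε : IsOpenEmbedding ε := e.symm.isOpenEmbedding
  refine ⟨EmbSp.precomp L ψ hψ, fun _ _ => rfl, EmbSp.precomp L ε hε, ?_, ?_⟩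
  · exact EmbSp.precomp_homotopic L (ε.comp H) (fun t => hε.comp (hH t))
      (φ₀ := ε.comp ψ) (φ₁ := ContinuousMap.id M) (hε.comp hψ) IsOpenEmbedding.id
      (fun x => congrArg ε (hH0 x)) (fun x => (congrArg ε (he x)).trans (e.symm_apply_apply x))
  · exact EmbSp.precomp_homotopic L (H.comp ((ContinuousMap.id unitInterval).prodMap ε))
      (fun t => (hH t).comp hε)
      (φ₀ := ψ.comp ε) (φ₁ := ContinuousMap.id N) (hψ.comp hε) IsOpenEmbedding.id
      (fun x => hH0 (ε x)) (fun x => (he (ε x)).trans (e.apply_symm_apply x))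
end

section
/- The space Emb^or(ℝ,ℝ) = {f ∈ C(ℝ,ℝ) | f is strictly increasing} of orientation-preserving open topological embeddings of ℝ into itself, equipped with the compact-open topology, is a contractible topological space. (This is the contractibility of embedding spaces between connected oriented 1-manifolds used to identify oriented 1-disk algebras with associative algebras.) -/
theorem ContinuousMap.convex_setOf_strictMono {X : Type*} [TopologicalSpace X] [Preorder X] :
    Convex ℝ {f : C(X, ℝ) | StrictMono f} := by
  intro f hf g hg a b ha hb hab x y hxy
  have hfx : f x < f y := hf hxy
  have hgx : g x < g y := hg hxy
  change a * f x + b * g x < a * f y + b * g y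
  rcases ha.eq_or_lt with rfl | ha
  · obtain rfl : b = 1 := by simpa using hab
    simpa using hgx
  · exact add_lt_add_of_lt_of_le (mul_lt_mul_of_pos_left hfx ha)
      (mul_le_mul_of_nonneg_left hgx.le hb)

/-- The space of orientation-preserving open topological embeddings `ℝ ↪ ℝ`,
i.e. strictly increasing continuous self-maps of `ℝ`, with the compact-open
topology, is contractible. -/
theorem contractible_orientation_preserving_embeddings_of_real :
    ContractibleSpace {f : C(ℝ, ℝ) // StrictMono f} :=
  ContinuousMap.convex_setOf_strictMono.contractibleSpace ⟨ContinuousMap.id ℝ, strictMono_id⟩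
end
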